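/- Let n ≥ 3 and let P₀,…,P_{n−1} be points of ℝ² (indices mod n) such that no edge line P_jP_{j+1} passes through the origin 0, and let Q_j = (P_jP_{j+1})* be the polar dual point of the j-th edge line. Let (M_j)_{j∈ℤ} be an orbit of the centrally-projective polygon CPol(0; P₀,…,P_{n−1}): for every j ∈ ℤ, M_j lies on the line P_jP_{j+1} (indices mod n) and the quadruple of lines through M_j, (M_{j−1}M_j, M_jM_{j+1}; line through M_j and 0, P_jP_{j+1}), is harmonic. Then no line M_{j−1}M_j passes through 0, and the dual points N_j = (M_{j−1}M_j)* satisfy N_{j+1} = 2·Q_j − N_j for every j ∈ ℤ; in other words, (N_j) is an outer ghost orbit of the dual polygon Q₀⋯Q_{n−1}. Moreover, for any integers j, m, the lines M_{j−1}M_j and M_{m−1}M_m coincide if and only if N_j = N_m; in particular (M_j) is m-periodic if and only if (N_j) is m-periodic. -/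

import Mathlib

/-- The standard dot product on `ℝ²`. -/
def dot (u v : ℝ × ℝ) : ℝ := u.1 * v.1 + u.2 * v.2

/-- The affine line of `ℝ²` through the points `A` and `B`, as a set of points. -/
def lineThrough (A B : ℝ × ℝ) : Set (ℝ × ℝ) :=
  {X | ∃ t : ℝ, X = A + t • (B - A)}

/-- Four lines through a common point, with respective direction vectors `d₁ d₂ d₃ d₄`,
form a harmonic quadruple `(ℓ₁, ℓ₂; ℓ₃, ℓ₄) = -1`: the first two lines admit direction
vectors of the form `a • d₃ + b • d₄` and `a • d₃ - b • d₄` with `a, b` nonzero scalars. -/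
def HarmonicLines (d₁ d₂ d₃ d₄ : ℝ × ℝ) : Prop :=
  ∃ a b : ℝ, a ≠ 0 ∧ b ≠ 0 ∧
    (∃ s : ℝ, s ≠ 0 ∧ d₁ = s • (a • d₃ + b • d₄)) ∧
    (∃ t : ℝ, t ≠ 0 ∧ d₂ = t • (a • d₃ - b • d₄))

/-- The determinant of the pair of plane vectors `(u, v)`. -/
def planeDet (u v : ℝ × ℝ) : ℝ := u.1 * v.2 - u.2 * v.1

/-- The polar dual point of the line `AB`, meaningful when that line avoids the origin. -/
noncomputable def dualPoint (A B : ℝ × ℝ) : ℝ × ℝ :=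
  ((B.2 - A.2) / planeDet A B, (A.1 - B.1) / planeDet A B)

theorem left_mem_lineThrough (A B : ℝ × ℝ) : A ∈ lineThrough A B := ⟨0, by simp⟩

theorem right_mem_lineThrough (A B : ℝ × ℝ) : B ∈ lineThrough A B := ⟨1, by simp⟩

theorem dot_zero (u : ℝ × ℝ) : dot u 0 = 0 := by simp [dot]

theorem dot_sub (u v w : ℝ × ℝ) : dot u (v - w) = dot u v - dot u w := by
  simp only [dot, Prod.fst_sub, Prod.snd_sub]
  ring

/-- A vector is determined by its dot products with two independent vectors. -/
theorem eq_of_dot_eq {u w x y : ℝ × ℝ} (h : planeDet x y ≠ 0)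
    (hx : dot u x = dot w x) (hy : dot u y = dot w y) : u = w := by
  simp only [planeDet, dot] at h hx hy
  refine Prod.ext (mul_right_cancel₀ h ?_) (mul_right_cancel₀ h ?_)
  · linear_combination y.2 * hx - x.2 * hy
  · linear_combination x.1 * hy - y.1 * hx

theorem mem_lineThrough_iff_dot_dualPoint {A B : ℝ × ℝ} (h : planeDet A B ≠ 0) (x : ℝ × ℝ) :
    x ∈ lineThrough A B ↔ dot (dualPoint A B) x = 1 := by
  have hdot : dot (dualPoint A B) x =
      ((B.2 - A.2) * x.1 + (A.1 - B.1) * x.2) / planeDet A B := by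
    simp only [dot, dualPoint]
    ring
  rw [hdot, div_eq_one_iff_eq h]
  constructor
  · rintro ⟨t, rfl⟩
    simp only [planeDet, Prod.fst_add, Prod.snd_add, Prod.smul_fst, Prod.smul_snd,
      Prod.fst_sub, Prod.snd_sub, smul_eq_mul]
    ring
  · intro hx
    have hBA : dot (B - A) (B - A) ≠ 0 := by
      intro h0
      simp only [dot, Prod.fst_sub, Prod.snd_sub] at h0
      obtain ⟨h1, h2⟩ := (mul_self_add_mul_self_eq_zero).1 h0
      apply h
      simp only [planeDet]
      linear_combination A.1 * h2 - A.2 * h1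
    refine ⟨dot (B - A) (x - A) / dot (B - A) (B - A), ?_⟩
    rw [← sub_eq_iff_eq_add', div_eq_inv_mul, mul_smul, eq_inv_smul_iff₀ hBA]
    simp only [planeDet] at hx
    refine Prod.ext ?_ ?_ <;>
      simp only [dot, Prod.smul_fst, Prod.smul_snd, Prod.fst_sub, Prod.snd_sub, smul_eq_mul]
    · linear_combination (B.2 - A.2) * hx
    · linear_combination (A.1 - B.1) * hx

/-- If the line `AB` is the full level set `{x | ⟨q, x⟩ = 1}`, its points are distinct. -/
theorem sub_ne_zero_of_lineThrough_eq_dual {A B q : ℝ × ℝ}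
    (h : ∀ x, x ∈ lineThrough A B ↔ dot q x = 1) : B - A ≠ 0 := by
  intro hBA
  have hA : dot q A = 1 := (h A).1 (left_mem_lineThrough A B)
  have hmem : A + (-q.2, q.1) ∈ lineThrough A B := by
    rw [h, ← hA]
    simp only [dot, Prod.fst_add, Prod.snd_add]
    ring
  obtain ⟨t, ht⟩ := hmem
  rw [hBA, smul_zero, add_right_inj, Prod.mk_eq_zero, neg_eq_zero] at ht
  simp [dot, ht.1, ht.2] at hA

theorem planeDet_ne_zero_of_dot {q x v : ℝ × ℝ} (hx : dot q x = 1) (hv : dot q v = 0)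
    (hv0 : v ≠ 0) : planeDet x v ≠ 0 := by
  intro h
  simp only [planeDet, dot] at h hx hv
  refine hv0 (Prod.ext ?_ ?_)
  · change v.1 = 0
    linear_combination (-v.1) * hx + x.1 * hv - q.2 * h
  · change v.2 = 0
    linear_combination (-v.2) * hx + x.2 * hv + q.1 * h

/-- The dual points of two lines through `x` that are harmonic with respect to the line `x0`
and the line through `x` directed by `v` have the dual point of the latter as midpoint. -/
theorem HarmonicLines.dual_eq_two_smul_sub {x y z v q N N' : ℝ × ℝ}
    (h : HarmonicLines (y - x) (z - x) (0 - x) v) (hdet : planeDet x v ≠ 0)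
    (hqx : dot q x = 1) (hqv : dot q v = 0)
    (hNx : dot N x = 1) (hNy : dot N y = 1) (hN'x : dot N' x = 1) (hN'z : dot N' z = 1) :
    N' = (2 : ℝ) • q - N := by
  obtain ⟨a, b, -, hb, ⟨s, hs, hy⟩, t, ht, hz⟩ := h
  have hy' := congrArg (dot N) hy
  have hz' := congrArg (dot N') hz
  rw [dot_sub, hNx, hNy] at hy'
  rw [dot_sub, hN'x, hN'z] at hz'
  have hNv : b * dot N v = a := by
    refine mul_left_cancel₀ hs ?_
    simp only [dot, Prod.fst_add, Prod.snd_add, Prod.fst_sub, Prod.snd_sub, Prod.smul_fst,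
      Prod.smul_snd, Prod.fst_zero, Prod.snd_zero, smul_eq_mul] at hy' hNx ⊢
    linear_combination -hy' + s * a * hNx
  have hN'v : b * dot N' v = -a := by
    refine mul_left_cancel₀ ht ?_
    simp only [dot, Prod.fst_sub, Prod.snd_sub, Prod.smul_fst, Prod.smul_snd, Prod.fst_zero,
      Prod.snd_zero, smul_eq_mul] at hz' hN'x ⊢
    linear_combination hz' - t * a * hN'x
  have hv : dot N' v = -dot N v := mul_left_cancel₀ hb (by linear_combination hN'v + hNv)
  refine eq_of_dot_eq hdet ?_ ?_
  · simp only [dot, Prod.fst_sub, Prod.snd_sub, Prod.smul_fst, Prod.smul_snd, smul_eq_mul]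
      at hqx hNx hN'x ⊢
    linear_combination hN'x + hNx - 2 * hqx
  · simp only [dot, Prod.fst_sub, Prod.snd_sub, Prod.smul_fst, Prod.smul_snd, smul_eq_mul]
      at hqv hv ⊢
    linear_combination hv - 2 * hqv

theorem HarmonicLines.planeDet_ne_zero {x y z v : ℝ × ℝ}
    (h : HarmonicLines (y - x) (z - x) (0 - x) v) (hdet : planeDet x v ≠ 0) :
    planeDet y x ≠ 0 := by
  obtain ⟨a, b, -, hb, ⟨s, hs, hy⟩, -⟩ := h
  have key : planeDet y x = -(s * b * planeDet x v) := by
    rw [eq_add_of_sub_eq hy]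
    simp only [planeDet, Prod.fst_add, Prod.snd_add, Prod.smul_fst, Prod.smul_snd,
      Prod.fst_sub, Prod.snd_sub, Prod.fst_zero, Prod.snd_zero, smul_eq_mul]
    ring
  rw [key]
  exact neg_ne_zero.2 (mul_ne_zero (mul_ne_zero hs hb) hdet)

/-- An orbit `(M_j)` of the centrally-projective polygon `CPol(0; P₀,…,P_{n-1})` has all
its lines `M_{j-1}M_j` avoiding the origin; its dual points `N_j = (M_{j-1}M_j)*` form an
outer ghost orbit of the dual polygon `Q₀⋯Q_{n-1}` (i.e. `N_{j+1} = 2 Q_j - N_j`), and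
two lines of the orbit coincide if and only if the corresponding dual points do; in
particular the orbit is `m`-periodic iff its dual orbit is. -/
theorem centrallyProjective_dual_ghost_orbit
    (n : ℕ) (hn : 3 ≤ n)
    (P : ℤ → ℝ × ℝ) (hper : ∀ j : ℤ, P (j + (n : ℤ)) = P j)
    (hedge : ∀ j : ℤ, (0 : ℝ × ℝ) ∉ lineThrough (P j) (P (j + 1)))
    (Q : ℤ → ℝ × ℝ)
    (hQ : ∀ j : ℤ, ∀ x : ℝ × ℝ, x ∈ lineThrough (P j) (P (j + 1)) ↔ dot (Q j) x = 1)
    (M : ℤ → ℝ × ℝ)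
    (hside : ∀ j : ℤ, M j ∈ lineThrough (P j) (P (j + 1)))
    (hrefl : ∀ j : ℤ, HarmonicLines (M (j - 1) - M j) (M (j + 1) - M j)
      ((0 : ℝ × ℝ) - M j) (P (j + 1) - P j)) :
    (∀ j : ℤ, (0 : ℝ × ℝ) ∉ lineThrough (M (j - 1)) (M j)) ∧
    ∃ N : ℤ → ℝ × ℝ,
      (∀ j : ℤ, ∀ x : ℝ × ℝ, x ∈ lineThrough (M (j - 1)) (M j) ↔ dot (N j) x = 1) ∧
      (∀ j : ℤ, N (j + 1) = (2 : ℝ) • Q j - N j) ∧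
      (∀ j m : ℤ,
        lineThrough (M (j - 1)) (M j) = lineThrough (M (m - 1)) (M m) ↔ N j = N m) := by
  have hQM (j : ℤ) : dot (Q j) (M j) = 1 := (hQ j _).1 (hside j)
  have hQv (j : ℤ) : dot (Q j) (P (j + 1) - P j) = 0 := by
    rw [dot_sub, (hQ j _).1 (left_mem_lineThrough _ _), (hQ j _).1 (right_mem_lineThrough _ _),
      sub_self]
  have hMv (j : ℤ) : planeDet (M j) (P (j + 1) - P j) ≠ 0 :=
    planeDet_ne_zero_of_dot (hQM j) (hQv j) (sub_ne_zero_of_lineThrough_eq_dual (hQ j))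
  have hMM (j : ℤ) : planeDet (M (j - 1)) (M j) ≠ 0 := (hrefl j).planeDet_ne_zero (hMv j)
  have hN (j : ℤ) (x : ℝ × ℝ) := mem_lineThrough_iff_dot_dualPoint (hMM j) x
  have hleft (j : ℤ) := (hN j _).1 (left_mem_lineThrough _ _)
  have hright (j : ℤ) := (hN j _).1 (right_mem_lineThrough _ _)
  refine ⟨fun j h0 => ?_, fun j => dualPoint (M (j - 1)) (M j), hN, fun j => ?_,
    fun j m => ⟨fun h => ?_, fun h => ?_⟩⟩
  · rw [hN, dot_zero] at h0
    exact zero_ne_one h0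
  · refine (hrefl j).dual_eq_two_smul_sub (hMv j) (hQM j) (hQv j) (hright j) (hleft j) ?_
      (hright (j + 1))
    simpa only [add_sub_cancel_right] using hleft (j + 1)
  · refine eq_of_dot_eq (hMM j) ?_ ?_
    · rw [hleft j, (hN m _).1 (h ▸ left_mem_lineThrough _ _)]
    · rw [hright j, (hN m _).1 (h ▸ right_mem_lineThrough _ _)]
  · ext x
    rw [hN j, hN m]
    exact Eq.congr_left (congrArg (dot · x) h)
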